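/- arXiv:0807.3573 — 2 statements merged into one kernel-verified Lean document; each statement's English description precedes it below -/
import Mathlib

section
/- First variation of the polytropic internal energy under transport perturbations: Let d ≥ 1, γ > 1, let ρ : ℝ^d → [0,∞) be a Borel probability density (∫ρ = 1) with ∫_{ℝ^d} ρ(x)^γ dx < ∞, and let ζ : ℝ^d → ℝ^d be smooth with compact support. For each ε ∈ ℝ with |ε| small enough that x ↦ x + εζ(x) is a diffeomorphism of ℝ^d, the pushforward measure (id + εζ)#(ρ·Lebesgue) is absolutely continuous; let ρ_ε denote its density. Then lim_{ε→0} (1/ε) ( ∫_{ℝ^d} ρ_ε(z)^γ/(γ−1) dz − ∫_{ℝ^d} ρ(x)^γ/(γ−1) dx ) = − ∫_{ℝ^d} ρ(x)^γ (div ζ)(x) dx. -/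
open MeasureTheory Filter
open scoped ENNReal Topology

/-- Monge–Ampère (Jacobian) equation for an injective differentiable transport map. -/
theorem ae_eq_abs_det_mul_comp_of_map_withDensity {E : Type*} [NormedAddCommGroup E]
    [NormedSpace ℝ E] [FiniteDimensional ℝ E] [MeasurableSpace E] [BorelSpace E]
    (μ : Measure E) [μ.IsAddHaarMeasure] {T : E → E} {T' : E → E →L[ℝ] E}
    (hT : ∀ x, HasFDerivAt T (T' x) x) (hinj : Function.Injective T) {f g : E → ℝ≥0∞}
    (hf : Measurable f) (hg : Measurable g)
    (hmap : (μ.withDensity f).map T = μ.withDensity g) :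
    f =ᵐ[μ] fun x => ENNReal.ofReal |(T' x).det| * g (T x) := by
  have hTc : Continuous T := continuous_iff_continuousAt.2 fun x => (hT x).continuousAt
  have hT' : T' = fderiv ℝ T := funext fun x => (hT x).fderiv.symm
  have hT'm : Measurable fun x => (T' x).det := by
    rw [hT']
    exact ContinuousLinearMap.continuous_det.measurable.comp (measurable_fderiv ℝ T)
  have hmeas : Measurable fun x => ENNReal.ofReal |(T' x).det| * g (T x) :=
    (hT'm.abs.ennreal_ofReal).mul (hg.comp hTc.measurable)
  refine (withDensity_eq_iff_of_sigmaFinite hf.aemeasurable hmeas.aemeasurable).1 ?_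
  ext s hs
  have himg : MeasurableSet (T '' s) := measurable_image_of_fderivWithin hs
    (fun x _ => (hT x).hasFDerivWithinAt) hinj.injOn
  have h := congrArg (fun ν : Measure E => ν (T '' s)) hmap
  simp only [Measure.map_apply hTc.measurable himg, hinj.preimage_image,
    withDensity_apply _ himg] at h
  rw [h, withDensity_apply _ hs, lintegral_image_eq_lintegral_abs_det_fderiv_mul μ hs
    (fun x _ => (hT x).hasFDerivWithinAt) hinj.injOn]

/-- A transported density vanishes almost everywhere outside the range of the transport map. -/
theorem ae_eq_zero_of_notMem_range_of_map_withDensity {E : Type*} [MeasurableSpace E]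
    {μ : Measure E} {T : E → E} (hT : Measurable T) (hrange : MeasurableSet (Set.range T))
    {f g : E → ℝ≥0∞} (hg : Measurable g)
    (hmap : (μ.withDensity f).map T = μ.withDensity g) :
    ∀ᵐ z ∂μ, z ∉ Set.range T → g z = 0 := by
  have h := congrArg (fun ν : Measure E => ν (Set.range T)ᶜ) hmap
  simp only [Measure.map_apply hT hrange.compl, Set.preimage_compl, Set.preimage_range,
    Set.compl_univ, measure_empty, withDensity_apply _ hrange.compl] at h
  exact (setLIntegral_eq_zero_iff hrange.compl hg).1 h.symm

/-- The integral of a power of a transported density, expressed in the original variables. -/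
theorem integral_rpow_of_map_withDensity {E : Type*} [NormedAddCommGroup E]
    [NormedSpace ℝ E] [FiniteDimensional ℝ E] [MeasurableSpace E] [BorelSpace E]
    (μ : Measure E) [μ.IsAddHaarMeasure] {T : E → E} {T' : E → E →L[ℝ] E}
    (hT : ∀ x, HasFDerivAt T (T' x) x) (hinj : Function.Injective T)
    (hdet : ∀ x, 0 < (T' x).det) {f g : E → ℝ}
    (hf : Measurable f) (hf0 : ∀ x, 0 ≤ f x) (hg : Measurable g) (hg0 : ∀ x, 0 ≤ g x)
    (hmap : (μ.withDensity fun x => ENNReal.ofReal (f x)).map T =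
      μ.withDensity fun x => ENNReal.ofReal (g x)) {γ : ℝ} (hγ : γ ≠ 0) :
    ∫ z, g z ^ γ ∂μ = ∫ x, f x ^ γ * (T' x).det ^ (1 - γ) ∂μ := by
  have hTc : Continuous T := continuous_iff_continuousAt.2 fun x => (hT x).continuousAt
  have hrange : MeasurableSet (Set.range T) := by
    rw [← Set.image_univ]
    exact measurable_image_of_fderivWithin MeasurableSet.univ
      (fun x _ => (hT x).hasFDerivWithinAt) hinj.injOn
  have hzero : ∀ᵐ z ∂μ, z ∉ Set.range T → g z ^ γ = 0 := by
    filter_upwards [ae_eq_zero_of_notMem_range_of_map_withDensity hTc.measurable hrange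
      hg.ennreal_ofReal hmap] with z hz hzT
    have hgz : g z = 0 := le_antisymm (ENNReal.ofReal_eq_zero.1 (hz hzT)) (hg0 z)
    rw [hgz, Real.zero_rpow hγ]
  rw [← setIntegral_eq_integral_of_ae_compl_eq_zero hzero, ← Set.image_univ,
    integral_image_eq_integral_abs_det_fderiv_smul μ MeasurableSet.univ
      (fun x _ => (hT x).hasFDerivWithinAt) hinj.injOn, Measure.restrict_univ]
  refine integral_congr_ae ?_
  filter_upwards [ae_eq_abs_det_mul_comp_of_map_withDensity μ hT hinj hf.ennreal_ofReal
    hg.ennreal_ofReal hmap] with x hx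
  have hfx : f x = (T' x).det * g (T x) := by
    rw [abs_of_pos (hdet x), ← ENNReal.ofReal_mul (hdet x).le,
      ENNReal.ofReal_eq_ofReal_iff (hf0 x) (mul_nonneg (hdet x).le (hg0 _))] at hx
    exact hx
  rw [hfx, Real.mul_rpow (hdet x).le (hg0 _), abs_of_pos (hdet x), smul_eq_mul,
    Real.rpow_sub (hdet x), Real.rpow_one]
  have := (Real.rpow_pos_of_pos (hdet x) γ).ne'
  field_simp

theorem ContinuousLinearMap.det_eq_det_of_single {ι : Type*} [Fintype ι] [DecidableEq ι]
    (A : (ι → ℝ) →L[ℝ] (ι → ℝ)) :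
    A.det = (Matrix.of fun i j => A (Pi.single j 1) i).det := by
  rw [ContinuousLinearMap.det, ← LinearMap.det_toMatrix']
  congr 1

theorem ContinuousLinearMap.contDiff_det_pi {ι : Type*} [Fintype ι] [DecidableEq ι]
    {n : WithTop ℕ∞} :
    ContDiff ℝ n fun A : (ι → ℝ) →L[ℝ] (ι → ℝ) => A.det := by
  simp only [ContinuousLinearMap.det_eq_det_of_single, Matrix.det_apply, Matrix.of_apply]
  refine ContDiff.sum fun σ _ => ContDiff.const_smul _ (contDiff_prod fun i _ => ?_)
  exact (contDiff_apply ℝ ℝ (σ i)).comp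
    (ContinuousLinearMap.apply ℝ (ι → ℝ) (Pi.single i 1 : ι → ℝ)).contDiff

/-- The derivative of the determinant at the identity is the trace. -/
theorem ContinuousLinearMap.hasDerivAt_det_one_add_smul {ι : Type*} [Fintype ι] [DecidableEq ι]
    (A : (ι → ℝ) →L[ℝ] (ι → ℝ)) :
    HasDerivAt (fun t : ℝ => (1 + t • A).det) (∑ j, A (Pi.single j 1) j) 0 := by
  set M : Matrix ι ι ℝ := Matrix.of fun i j => A (Pi.single j 1) i with hM
  set p := (Matrix.det (1 + (Polynomial.X : Polynomial ℝ) • M.map Polynomial.C)).divX.divX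
  have h : (fun t : ℝ => (1 + t • A).det) =
      fun t => 1 + M.trace * t + p.eval t * t ^ 2 := by
    ext t
    rw [← Matrix.det_one_add_smul, ContinuousLinearMap.det_eq_det_of_single]
    congr 1
    ext i j
    simp [hM, Matrix.one_apply, Pi.single_apply]
  have htr : M.trace = ∑ j, A (Pi.single j 1) j := by simp [Matrix.trace, hM]
  rw [h, ← htr]
  simpa using (((hasDerivAt_id' (0 : ℝ)).const_mul M.trace).const_add 1).fun_add
    ((p.hasDerivAt 0).fun_mul ((hasDerivAt_id' (0 : ℝ)).fun_pow 2))

theorem injective_id_add_smul_of_lipschitzWith {E : Type*} [NormedAddCommGroup E]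
    [NormedSpace ℝ E] {ζ : E → E} {C : NNReal} (hζ : LipschitzWith C ζ) {ε : ℝ}
    (hε : |ε| * C < 1) : Function.Injective fun x => x + ε • ζ x := by
  intro x y hxy
  have h1 : x - y = -(ε • (ζ x - ζ y)) := by
    have : x + ε • ζ x = y + ε • ζ y := hxy
    rw [smul_sub, neg_sub, sub_eq_sub_iff_add_eq_add, this, add_comm]
  have h2 : ‖x - y‖ ≤ |ε| * C * ‖x - y‖ := by
    calc ‖x - y‖ = |ε| * ‖ζ x - ζ y‖ := by rw [h1, norm_neg, norm_smul, Real.norm_eq_abs]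
      _ ≤ |ε| * (C * ‖x - y‖) := by gcongr; exact hζ.norm_sub_le x y
      _ = _ := by ring
  have h3 : ‖x - y‖ ≤ 0 := by nlinarith [norm_nonneg (x - y)]
  exact sub_eq_zero.1 (norm_le_zero_iff.1 h3)

/-- Derivative under the integral sign for a function of the scaled operators `ε • A x`, where
`A` is bounded. -/
theorem hasDerivAt_integral_mul_comp_smul {X F : Type*} [MeasurableSpace X]
    [NormedAddCommGroup F] [NormedSpace ℝ F] [MeasurableSpace F] [BorelSpace F]
    [SecondCountableTopology F] {μ : Measure X} {w : X → ℝ}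
    (hw : Integrable w μ) (hw0 : ∀ x, 0 ≤ w x) {A : X → F} (hA : Measurable A) {C : ℝ}
    (hAC : ∀ x, ‖A x‖ ≤ C) {φ : F → ℝ} (hφm : Measurable φ) (hφ : ContDiffAt ℝ 1 φ 0) :
    HasDerivAt (fun ε : ℝ => ∫ x, w x * φ (ε • A x) ∂μ)
      (∫ x, w x * fderiv ℝ φ 0 (A x) ∂μ) 0 := by
  obtain ⟨K, t, ht, hK⟩ := hφ.exists_lipschitzOnWith
  obtain ⟨r, hr, hrt⟩ := Metric.mem_nhds_iff.1 ht
  have hC : 0 ≤ max C 0 := le_max_right _ _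
  have hs : {ε : ℝ | |ε| * max C 0 < r} ∈ 𝓝 (0 : ℝ) :=
    (isOpen_lt (by fun_prop) continuous_const).mem_nhds (by simpa using hr)
  have hmem : ∀ ε ∈ {ε : ℝ | |ε| * max C 0 < r}, ∀ x, ε • A x ∈ t := by
    intro ε hε x
    apply hrt
    rw [mem_ball_zero_iff, norm_smul, Real.norm_eq_abs]
    refine lt_of_le_of_lt ?_ hε
    gcongr
    exact (hAC x).trans (le_max_left _ _)
  refine (hasDerivAt_integral_of_dominated_loc_of_lip
    (F := fun ε x => w x * φ (ε • A x)) (F' := fun x => w x * fderiv ℝ φ 0 (A x))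
    (bound := fun x => w x * (K * max C 0)) hs ?_ ?_ ?_ ?_ ?_ ?_).2
  · exact .of_forall fun ε => hw.aestronglyMeasurable.mul
      (hφm.comp (hA.const_smul ε)).aestronglyMeasurable
  · simpa using hw.mul_const (φ 0)
  · exact hw.aestronglyMeasurable.mul
      ((fderiv ℝ φ 0).continuous.measurable.comp hA).aestronglyMeasurable
  · refine .of_forall fun x => LipschitzOnWith.of_dist_le_mul fun ε hε δ hδ => ?_
    have hb : 0 ≤ w x * (K * max C 0) := mul_nonneg (hw0 x) (by positivity)
    rw [Real.dist_eq, Real.dist_eq, ← mul_sub, abs_mul, abs_of_nonneg (hw0 x),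
      Real.coe_nnabs, abs_of_nonneg hb, mul_assoc]
    refine mul_le_mul_of_nonneg_left ?_ (hw0 x)
    have h := hK.norm_sub_le (hmem ε hε x) (hmem δ hδ x)
    rw [← sub_smul, norm_smul, Real.norm_eq_abs, Real.norm_eq_abs] at h
    calc _ ≤ _ := h
      _ ≤ K * (|ε - δ| * max C 0) := by
        gcongr
        exact (hAC x).trans (le_max_left _ _)
      _ = _ := by ring
  · exact hw.mul_const _
  · refine .of_forall fun x => HasDerivAt.const_mul _ ?_
    have h1 : HasDerivAt (fun ε : ℝ => ε • A x) (A x) 0 := by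
      simpa using (hasDerivAt_id (0 : ℝ)).smul_const (A x)
    have h2 : HasFDerivAt φ (fderiv ℝ φ 0) ((0 : ℝ) • A x) := by
      rw [zero_smul]
      exact (hφ.differentiableAt one_ne_zero).hasFDerivAt
    exact h2.comp_hasDerivAt (0 : ℝ) h1

/-- **First variation of the polytropic internal energy under transport perturbations.**
Let `ρ` be a Borel probability density on `ℝ^d` with `∫ ρ^γ < ∞` and `ζ` a smooth compactly
supported vector field. If, for all `ε` near `0`, the pushforward of `ρ·Lebesgue` under
`x ↦ x + εζ(x)` is absolutely continuous with density `ρ_ε`, then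
`lim_{ε→0} (1/ε)(∫ ρ_ε^γ/(γ-1) - ∫ ρ^γ/(γ-1)) = -∫ ρ^γ div ζ`. -/
theorem internal_energy_first_variation (d : ℕ) (hd : 1 ≤ d) (γ : ℝ) (hγ : 1 < γ)
    (ρ : (Fin d → ℝ) → ℝ) (hρmeas : Measurable ρ) (hρ0 : ∀ x, 0 ≤ ρ x)
    (hρ1 : ∫ x, ρ x = 1) (hργ : Integrable fun x => ρ x ^ γ)
    (ζ : (Fin d → ℝ) → (Fin d → ℝ)) (hζ : ContDiff ℝ (⊤ : ℕ∞) ζ) (hζc : HasCompactSupport ζ)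
    (ρε : ℝ → (Fin d → ℝ) → ℝ)
    (hρε : ∀ᶠ ε in 𝓝 (0 : ℝ),
        (∀ x, 0 ≤ ρε ε x) ∧ Measurable (ρε ε) ∧
        Measure.map (fun x => x + ε • ζ x)
            (volume.withDensity fun x => ENNReal.ofReal (ρ x)) =
          volume.withDensity fun x => ENNReal.ofReal (ρε ε x)) :
    Tendsto (fun ε : ℝ =>
        (1 / ε) * ((∫ z, ρε ε z ^ γ / (γ - 1)) - ∫ x, ρ x ^ γ / (γ - 1)))
      (𝓝[≠] 0)
      (𝓝 (-∫ x, ρ x ^ γ * ∑ j, fderiv ℝ ζ x (Pi.single j 1) j)) := by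
  have hγ1 : γ - 1 ≠ 0 := by linarith
  have hζ1 : ContDiff ℝ 1 ζ := hζ.of_le (by exact_mod_cast le_top)
  obtain ⟨C, hC⟩ := hζ1.lipschitzWith_of_hasCompactSupport hζc one_ne_zero
  set A : (Fin d → ℝ) → (Fin d → ℝ) →L[ℝ] (Fin d → ℝ) := fderiv ℝ ζ with hA
  have hAC : ∀ x, ‖A x‖ ≤ C := fun x => norm_fderiv_le_of_lipschitz ℝ hC
  have hAm : Measurable A := (hζ1.continuous_fderiv one_ne_zero).measurable
  set φ : ((Fin d → ℝ) →L[ℝ] (Fin d → ℝ)) → ℝ := fun B => (1 + B).det ^ (1 - γ) / (γ - 1)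
    with hφdef
  have hdet1 : (1 + (0 : (Fin d → ℝ) →L[ℝ] (Fin d → ℝ))).det = 1 := by
    simp [ContinuousLinearMap.det]
  have hdetC : ContDiff ℝ 1 fun B : (Fin d → ℝ) →L[ℝ] (Fin d → ℝ) => (1 + B).det :=
    ContinuousLinearMap.contDiff_det_pi.comp (contDiff_const.add contDiff_id)
  have hφ : ContDiffAt ℝ 1 φ 0 :=
    (hdetC.contDiffAt.rpow_const_of_ne (by rw [hdet1]; exact one_ne_zero)).div_const _
  have hφm : Measurable φ := (hdetC.continuous.measurable.pow_const _).div_const _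
  have hφ' : ∀ B, fderiv ℝ φ 0 B = -∑ j, B (Pi.single j 1) j := by
    intro B
    have h1 : HasDerivAt (fun t : ℝ => t • B) B 0 := by
      simpa using (hasDerivAt_id (0 : ℝ)).smul_const B
    have h2 : HasFDerivAt φ (fderiv ℝ φ 0) ((0 : ℝ) • B) := by
      rw [zero_smul]
      exact (hφ.differentiableAt one_ne_zero).hasFDerivAt
    have h3 := ((ContinuousLinearMap.hasDerivAt_det_one_add_smul B).rpow_const (p := 1 - γ)
      (Or.inl (by rw [zero_smul, hdet1]; exact one_ne_zero))).div_const (γ - 1)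
    have h4 := h2.comp_hasDerivAt (0 : ℝ) h1
    rw [h4.unique h3, zero_smul, hdet1, Real.one_rpow]
    field_simp
    ring
  have hderiv := hasDerivAt_integral_mul_comp_smul hργ (fun x => Real.rpow_nonneg (hρ0 x) γ)
    hAm hAC hφm hφ
  simp only [hφ', mul_neg, integral_neg] at hderiv
  refine hderiv.tendsto_slope.congr' ?_
  have hpos : ∀ᶠ B in 𝓝 (0 : (Fin d → ℝ) →L[ℝ] (Fin d → ℝ)), 0 < (1 + B).det :=
    hdetC.continuous.continuousAt.eventually (lt_mem_nhds (by simp only [hdet1, one_pos]))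
  obtain ⟨r, hr, hrpos⟩ := Metric.eventually_nhds_iff_ball.1 hpos
  have hsmall : ∀ᶠ ε in 𝓝 (0 : ℝ), |ε| * C < min 1 r :=
    (isOpen_lt (by fun_prop) continuous_const).mem_nhds (by simpa using hr)
  filter_upwards [nhdsWithin_le_nhds hρε, nhdsWithin_le_nhds hsmall] with ε hε hεC
  obtain ⟨hg0, hgm, hmap⟩ := hε
  have hT : ∀ x, HasFDerivAt (fun x => x + ε • ζ x) (1 + ε • A x) x := fun x =>
    (hasFDerivAt_id x).add
      ((hζ1.differentiable one_ne_zero).differentiableAt.hasFDerivAt.const_smul ε)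
  have hdet : ∀ x, 0 < (1 + ε • A x).det := by
    intro x
    apply hrpos
    rw [mem_ball_zero_iff, norm_smul, Real.norm_eq_abs]
    calc |ε| * ‖A x‖ ≤ |ε| * C := by gcongr; exact hAC x
      _ < r := hεC.trans_le (min_le_right _ _)
  have hint := integral_rpow_of_map_withDensity volume hT
    (injective_id_add_smul_of_lipschitzWith hC (hεC.trans_le (min_le_left _ _))) hdet
    hρmeas hρ0 hgm hg0 hmap (γ := γ) (by linarith)
  rw [slope_def_field, integral_div, hint, ← integral_div]
  simp only [hφdef, zero_smul, hdet1, Real.one_rpow, mul_one_div, mul_div_assoc, sub_zero]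
  rw [one_div_mul_eq_div]
end

section
/- Well-posedness and energy decrease for the minimizing movement (JKO) step: Let d ≥ 1, γ > 1, τ > 0, and let ρ₀ be a Borel probability density on ℝ^d with finite second moment and ∫_{ℝ^d} ρ₀(x)^γ dx < ∞. Then the functional ρ ↦ (1/(2τ)) W(ρ₀·Lebesgue, ρ·Lebesgue)² + ∫_{ℝ^d} ρ(x)^γ/(γ−1) dx admits a minimizer among all Borel probability densities on ℝ^d with finite second moment; the minimizer ρ₁ is unique up to equality Lebesgue-almost everywhere; and it satisfies ∫_{ℝ^d} ρ₁(x)^γ dx ≤ ∫_{ℝ^d} ρ₀(x)^γ dx. -/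
open MeasureTheory
open scoped ENNReal

/-- The squared quadratic Wasserstein distance between two Borel measures on `ℝ^d`:
the infimum of the quadratic transport cost over all couplings, i.e. measures on the
product space whose marginals are `μ` and `ν`. -/
noncomputable def W2sq {d : ℕ} (μ ν : Measure (EuclideanSpace ℝ (Fin d))) : ℝ≥0∞ :=
  ⨅ (γ : Measure (EuclideanSpace ℝ (Fin d) × EuclideanSpace ℝ (Fin d)))
    (_ : γ.map Prod.fst = μ) (_ : γ.map Prod.snd = ν),
    ∫⁻ p, ENNReal.ofReal (‖p.1 - p.2‖ ^ 2) ∂γ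

open Filter Topology

/-- A quantitative midpoint convexity inequality for `t ↦ t ^ γ`. -/
lemma midpoint_rpow_add_sq_le {γ a b : ℝ} (hγ : 1 < γ) (ha : 0 ≤ a) (hb : 0 ≤ b) :
    ((a + b) / 2) ^ γ + min 1 (γ - 1) / 4 * (a ^ (γ / 2) - b ^ (γ / 2)) ^ 2 ≤
      (a ^ γ + b ^ γ) / 2 := by
  set f := a ^ (γ / 2) with hf
  set g := b ^ (γ / 2) with hg
  have sq_half : ∀ t : ℝ, 0 ≤ t → t ^ γ = (t ^ (γ / 2)) ^ 2 := fun t ht ↦ by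
    rw [← Real.rpow_natCast, ← Real.rpow_mul ht]; norm_num
  have hf0 : 0 ≤ f := by positivity
  have hg0 : 0 ≤ g := by positivity
  rw [sq_half a ha, sq_half b hb, ← hf, ← hg]
  rcases le_or_gt 2 γ with h2 | h2
  · rw [min_eq_left (by linarith), sq_half _ (by positivity)]
    have hc := (convexOn_rpow (p := γ / 2) (by linarith)).2 (Set.mem_Ici.2 ha) (Set.mem_Ici.2 hb)
      (by norm_num : (0 : ℝ) ≤ 1 / 2) (by norm_num : (0 : ℝ) ≤ 1 / 2) (by norm_num)
    simp only [smul_eq_mul, ← hf, ← hg] at hc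
    have h3 : ((a + b) / 2) ^ (γ / 2) ≤ (f + g) / 2 := by
      rw [show (a + b) / 2 = 1 / 2 * a + 1 / 2 * b by ring]; linarith
    have h4 : 0 ≤ ((a + b) / 2) ^ (γ / 2) := by positivity
    nlinarith
  · rw [min_eq_right (by linarith)]
    set m := (f + g) / 2 with hm
    set q := (f ^ 2 + g ^ 2) / 2 with hq
    suffices h : ((a + b) / 2) ^ γ ≤ (γ - 1) * m ^ 2 + (2 - γ) * q by
      rw [hm, hq] at h; rw [hq]; linarith
    have hm0 : 0 ≤ m := by positivity
    rcases hm0.eq_or_lt with hm0 | hm0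
    · have hfg : f = 0 ∧ g = 0 := by constructor <;> linarith
      have ha' : a = 0 := ((Real.rpow_eq_zero_iff_of_nonneg ha).1 hfg.1).1
      have hb' : b = 0 := ((Real.rpow_eq_zero_iff_of_nonneg hb).1 hfg.2).1
      have : 0 ≤ q := by positivity
      rw [ha', hb', ← hm0]
      simp only [add_zero, zero_div]
      rw [Real.zero_rpow (by linarith)]
      nlinarith
    have hq0 : 0 < q := by nlinarith [sq_nonneg (f - g)]
    have hγ0 : γ ≠ 0 := by linarith
    have hp1 : 0 ≤ 2 - 2 / γ := by
      rw [sub_nonneg, div_le_iff₀ (by linarith)]; linarith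
    have hp2 : 0 ≤ 2 / γ - 1 := by
      rw [sub_nonneg, le_div_iff₀ (by linarith)]; linarith
    set C := m ^ (2 - 2 / γ) * q ^ (2 / γ - 1) with hC
    have hC0 : 0 < C := by positivity
    have young : ∀ t : ℝ, 0 ≤ t →
        t ≤ C * ((2 - 2 / γ) * (t ^ (γ / 2) / m) + (2 / γ - 1) * ((t ^ (γ / 2)) ^ 2 / q)) := by
      intro t ht
      have h := Real.geom_mean_le_arith_mean2_weighted hp1 hp2
        (p₁ := t ^ (γ / 2) / m) (p₂ := (t ^ (γ / 2)) ^ 2 / q) (by positivity) (by positivity)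
        (by ring)
      refine le_trans (le_of_eq ?_) (mul_le_mul_of_nonneg_left h hC0.le)
      rw [Real.div_rpow (by positivity) hm0.le, Real.div_rpow (by positivity) hq0.le,
        ← sq_half t ht, ← Real.rpow_mul ht, ← Real.rpow_mul ht, hC]
      have e : t = t ^ (γ / 2 * (2 - 2 / γ)) * t ^ (γ * (2 / γ - 1)) := by
        rw [← Real.rpow_add_of_nonneg ht (by positivity) (by positivity)]
        have : γ / 2 * (2 - 2 / γ) + γ * (2 / γ - 1) = 1 := by field_simp; ring
        rw [this, Real.rpow_one]
      have h1 : 0 < m ^ (2 - 2 / γ) := by positivity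
      have h2 : 0 < q ^ (2 / γ - 1) := by positivity
      conv_lhs => rw [e]
      field_simp
    have hle : (a + b) / 2 ≤ C := by
      have hs : (a + b) / 2 ≤ C * ((2 - 2 / γ) * (m / m) + (2 / γ - 1) * (q / q)) := by
        have h1 := young a ha
        have h2 := young b hb
        rw [← hf] at h1
        rw [← hg] at h2
        calc (a + b) / 2 ≤ _ := div_le_div_of_nonneg_right (add_le_add h1 h2) (by norm_num)
          _ = _ := by rw [hm, hq]; ring
      rw [div_self hm0.ne', div_self hq0.ne'] at hs
      linarith
    calc ((a + b) / 2) ^ γ ≤ C ^ γ := Real.rpow_le_rpow (by positivity) hle (by linarith)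
      _ = (m ^ 2) ^ (γ - 1) * q ^ (2 - γ) := by
        rw [hC, Real.mul_rpow (by positivity) (by positivity), ← Real.rpow_mul hm0.le,
          ← Real.rpow_mul hq0.le, ← Real.rpow_natCast, ← Real.rpow_mul hm0.le]
        congr 2 <;> (push_cast; field_simp)
      _ ≤ _ := Real.geom_mean_le_arith_mean2_weighted (by linarith) (by linarith)
        (by positivity) (by positivity) (by ring)

section Coupling

variable {d : ℕ}

lemma W2sq_le_lintegral (π : Measure (EuclideanSpace ℝ (Fin d) × EuclideanSpace ℝ (Fin d))) :
    W2sq (π.map Prod.fst) (π.map Prod.snd) ≤ ∫⁻ p, ENNReal.ofReal (‖p.1 - p.2‖ ^ 2) ∂π :=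
  (iInf_le _ π).trans <| (iInf_le _ rfl).trans (iInf_le _ rfl)

lemma exists_coupling_lt {μ ν : Measure (EuclideanSpace ℝ (Fin d))} {a : ℝ≥0∞}
    (h : W2sq μ ν < a) :
    ∃ π : Measure (EuclideanSpace ℝ (Fin d) × EuclideanSpace ℝ (Fin d)),
      π.map Prod.fst = μ ∧ π.map Prod.snd = ν ∧
        ∫⁻ p, ENNReal.ofReal (‖p.1 - p.2‖ ^ 2) ∂π < a := by
  simpa only [W2sq, iInf_lt_iff, exists_prop] using h

lemma W2sq_self (μ : Measure (EuclideanSpace ℝ (Fin d))) : W2sq μ μ = 0 := by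
  have hm : Measurable fun x : EuclideanSpace ℝ (Fin d) ↦ (x, x) := by fun_prop
  have h := W2sq_le_lintegral (μ.map fun x ↦ (x, x))
  rw [Measure.map_map measurable_fst hm, Measure.map_map measurable_snd hm,
    lintegral_map (by fun_prop) hm] at h
  simpa [Function.comp_def] using h

/-- The squared Wasserstein distance is convex along linear interpolations. -/
lemma W2sq_midpoint_le (μ ν ν' : Measure (EuclideanSpace ℝ (Fin d))) :
    W2sq μ ((2⁻¹ : ℝ≥0∞) • (ν + ν')) ≤ 2⁻¹ * (W2sq μ ν + W2sq μ ν') := by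
  rcases eq_or_ne (W2sq μ ν) ⊤ with h | h
  · simp [h, ENNReal.mul_top]
  rcases eq_or_ne (W2sq μ ν') ⊤ with h' | h'
  · simp [h', ENNReal.mul_top]
  refine ENNReal.le_of_forall_pos_le_add fun ε hε _ ↦ ?_
  have hε' : (ε : ℝ≥0∞) ≠ 0 := by simpa using hε.ne'
  obtain ⟨π, h1, h2, h3⟩ := exists_coupling_lt (ENNReal.lt_add_right h hε')
  obtain ⟨π', h1', h2', h3'⟩ := exists_coupling_lt (ENNReal.lt_add_right h' hε')
  have key := W2sq_le_lintegral ((2⁻¹ : ℝ≥0∞) • (π + π'))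
  have hμ : (2⁻¹ : ℝ≥0∞) • (μ + μ) = μ := by
    rw [← two_smul ℝ≥0∞ μ, smul_smul, ENNReal.inv_mul_cancel (by simp) (by simp), one_smul]
  rw [Measure.map_smul, Measure.map_smul, Measure.map_add _ _ measurable_fst,
    Measure.map_add _ _ measurable_snd, h1, h1', h2, h2', hμ, lintegral_smul_measure,
    lintegral_add_measure, smul_eq_mul] at key
  refine key.trans ((mul_le_mul_right (add_le_add h3.le h3'.le) _).trans (le_of_eq ?_))
  rw [add_add_add_comm, mul_add, ← two_mul (ε : ℝ≥0∞), ← mul_assoc,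
    ENNReal.inv_mul_cancel (by simp) (by simp), one_mul]

lemma ofReal_norm_sub_sq_le {F : Type*} [SeminormedAddCommGroup F] (x y : F) :
    ENNReal.ofReal (‖x - y‖ ^ 2) ≤
      2 * ENNReal.ofReal (‖x‖ ^ 2) + 2 * ENNReal.ofReal (‖y‖ ^ 2) := by
  rw [← ENNReal.ofReal_ofNat, ← ENNReal.ofReal_mul (by norm_num),
    ← ENNReal.ofReal_mul (by norm_num), ← ENNReal.ofReal_add (by positivity) (by positivity)]
  refine ENNReal.ofReal_le_ofReal ?_
  have := norm_sub_le x y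
  nlinarith [norm_nonneg (x - y), sq_nonneg (‖x‖ - ‖y‖)]

/-- A partial coupling is completed by the normalized product of the missing marginals. -/
lemma W2sq_add_le (π : Measure (EuclideanSpace ℝ (Fin d) × EuclideanSpace ℝ (Fin d)))
    (r s : Measure (EuclideanSpace ℝ (Fin d))) [IsFiniteMeasure r] [IsFiniteMeasure s]
    (hrs : r Set.univ = s Set.univ) :
    W2sq (π.map Prod.fst + r) (π.map Prod.snd + s) ≤
      ∫⁻ p, ENNReal.ofReal (‖p.1 - p.2‖ ^ 2) ∂π +
        (2 * ∫⁻ x, ENNReal.ofReal (‖x‖ ^ 2) ∂r + 2 * ∫⁻ x, ENNReal.ofReal (‖x‖ ^ 2) ∂s) := by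
  rcases eq_or_ne (r Set.univ) 0 with h0 | h0
  · have hr := Measure.measure_univ_eq_zero.1 h0
    have hs := Measure.measure_univ_eq_zero.1 (hrs ▸ h0)
    simpa [hr, hs] using W2sq_le_lintegral π
  have hs0 : s Set.univ ≠ 0 := hrs ▸ h0
  have hs : (s Set.univ)⁻¹ * s Set.univ = 1 :=
    ENNReal.inv_mul_cancel hs0 (measure_ne_top s _)
  have hfst : ((s Set.univ)⁻¹ • r.prod s).map Prod.fst = r := by
    rw [Measure.map_smul, Measure.map_fst_prod, smul_smul, hs, one_smul]
  have hsnd : ((s Set.univ)⁻¹ • r.prod s).map Prod.snd = s := by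
    rw [Measure.map_smul, Measure.map_snd_prod, smul_smul, hrs, hs, one_smul]
  have key := W2sq_le_lintegral (π + (s Set.univ)⁻¹ • r.prod s)
  rw [Measure.map_add _ _ measurable_fst, Measure.map_add _ _ measurable_snd, hfst, hsnd,
    lintegral_add_measure] at key
  refine key.trans (add_le_add_right ?_ _)
  have hN : Measurable fun x : EuclideanSpace ℝ (Fin d) ↦ ENNReal.ofReal (‖x‖ ^ 2) := by fun_prop
  calc _ ≤ ∫⁻ p, (2 * ENNReal.ofReal (‖p.1‖ ^ 2) + 2 * ENNReal.ofReal (‖p.2‖ ^ 2))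
        ∂((s Set.univ)⁻¹ • r.prod s) := lintegral_mono fun p ↦ ofReal_norm_sub_sq_le _ _
    _ = _ := by
      rw [lintegral_add_left (by fun_prop), lintegral_const_mul _ (by fun_prop),
        lintegral_const_mul _ (by fun_prop)]
      rw [← lintegral_map hN measurable_fst, ← lintegral_map hN measurable_snd, hfst, hsnd]

/-- Transferring the second marginal of a coupling from density `v` to density `u`. -/
lemma W2sq_withDensity_le (μ : Measure (EuclideanSpace ℝ (Fin d))) [IsProbabilityMeasure μ]
    {u v : EuclideanSpace ℝ (Fin d) → ℝ≥0∞} (hu : Measurable u) (hv : Measurable v)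
    (hvt : ∀ x, v x ≠ ⊤) (hu1 : ∫⁻ x, u x = 1) (K : ℝ≥0∞) :
    W2sq μ (volume.withDensity u) ≤ W2sq μ (volume.withDensity v) +
      (2 * (K * (∫⁻ x, (u x - v x)) + ∫⁻ x, (ENNReal.ofReal (‖x‖ ^ 2) - K) ∂μ) +
        2 * ∫⁻ x, (u x - v x) * ENNReal.ofReal (‖x‖ ^ 2)) := by
  rcases eq_or_ne (W2sq μ (volume.withDensity v)) ⊤ with h | h
  · simp [h]
  refine ENNReal.le_of_forall_pos_le_add fun ε hε _ ↦ ?_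
  have hε' : (ε : ℝ≥0∞) ≠ 0 := by simpa using hε.ne'
  obtain ⟨π, h1, h2, h3⟩ := exists_coupling_lt (ENNReal.lt_add_right h hε')
  set g : EuclideanSpace ℝ (Fin d) → ℝ≥0∞ := fun x ↦ min (u x) (v x) / v x with hg
  have hgm : Measurable g := by fun_prop
  have hg1 : ∀ x, g x ≤ 1 := fun x ↦ ENNReal.div_le_of_le_mul (by simp)
  set π' := π.withDensity fun p ↦ g p.2 with hπ'
  have hle : π' ≤ π := by
    calc π' ≤ π.withDensity 1 := withDensity_mono (ae_of_all _ fun p ↦ hg1 _)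
      _ = π := withDensity_one
  have hsnd : π'.map Prod.snd = volume.withDensity fun x ↦ min (u x) (v x) := by
    ext A hA
    have hpre : MeasurableSet (Prod.snd ⁻¹' A :
      Set (EuclideanSpace ℝ (Fin d) × EuclideanSpace ℝ (Fin d))) := measurable_snd hA
    rw [Measure.map_apply measurable_snd hA, hπ', withDensity_apply _ hpre,
      ← setLIntegral_map hA hgm measurable_snd, h2, withDensity_apply _ hA,
      restrict_withDensity hA, lintegral_withDensity_eq_lintegral_mul _ hv hgm]
    refine lintegral_congr fun x ↦ ?_
    simp only [Pi.mul_apply, hg]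
    rcases eq_or_ne (v x) 0 with h0 | h0
    · simp [h0]
    · exact ENNReal.mul_div_cancel h0 (hvt x)
  have hfst : π'.map Prod.fst ≤ μ := h1 ▸ Measure.map_mono hle measurable_fst
  have : IsFiniteMeasure (π'.map Prod.fst) :=
    ⟨(hfst Set.univ).trans_lt (measure_lt_top _ _)⟩
  set r := μ - π'.map Prod.fst with hr
  have hrle : r ≤ μ := Measure.sub_le
  have hfst' : π'.map Prod.fst + r = μ := by
    rw [add_comm, Measure.sub_add_cancel_of_le hfst]
  set s := (volume : Measure (EuclideanSpace ℝ (Fin d))).withDensity fun x ↦ u x - v x with hs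
  have hsum : ∀ x, min (u x) (v x) + (u x - v x) = u x := fun x ↦ by
    rw [add_comm, tsub_add_min]
  have hsnd' : π'.map Prod.snd + s = volume.withDensity u := by
    rw [hsnd, hs, ← withDensity_add_left (by fun_prop)]
    exact congrArg _ (funext hsum)
  have hsuniv : s Set.univ = ∫⁻ x, (u x - v x) := by
    rw [hs, withDensity_apply _ MeasurableSet.univ, setLIntegral_univ]
  have : IsFiniteMeasure r := isFiniteMeasure_of_le μ hrle
  have : IsFiniteMeasure s := ⟨by
    rw [hsuniv]
    exact (lintegral_mono fun x ↦ tsub_le_self).trans_lt (hu1 ▸ ENNReal.one_lt_top)⟩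
  have hrs : r Set.univ = s Set.univ := by
    have e1 : π' Set.univ + r Set.univ = 1 := by
      have := congrArg (fun m : Measure (EuclideanSpace ℝ (Fin d)) ↦ m Set.univ) hfst'
      simpa [Measure.map_apply measurable_fst MeasurableSet.univ] using this
    have e2 : π' Set.univ + s Set.univ = 1 := by
      have := congrArg (fun m : Measure (EuclideanSpace ℝ (Fin d)) ↦ m Set.univ) hsnd'
      simpa [Measure.map_apply measurable_snd MeasurableSet.univ, hu1] using this
    have ht : π' Set.univ ≠ ⊤ := ne_top_of_le_ne_top ENNReal.one_ne_top (e1 ▸ le_self_add)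
    exact (ENNReal.add_right_inj ht).1 (e1.trans e2.symm)
  have key := W2sq_add_le π' r s hrs
  rw [hfst', hsnd'] at key
  have hcost : ∫⁻ p, ENNReal.ofReal (‖p.1 - p.2‖ ^ 2) ∂π' ≤ W2sq μ (volume.withDensity v) + ε :=
    (lintegral_mono' hle le_rfl).trans h3.le
  have hrm : ∫⁻ x, ENNReal.ofReal (‖x‖ ^ 2) ∂r ≤
      K * (∫⁻ x, (u x - v x)) + ∫⁻ x, (ENNReal.ofReal (‖x‖ ^ 2) - K) ∂μ := by
    calc ∫⁻ x, ENNReal.ofReal (‖x‖ ^ 2) ∂r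
        ≤ ∫⁻ x, (K + (ENNReal.ofReal (‖x‖ ^ 2) - K)) ∂r := lintegral_mono fun x ↦ le_add_tsub
      _ = K * (∫⁻ x, (u x - v x)) + ∫⁻ x, (ENNReal.ofReal (‖x‖ ^ 2) - K) ∂r := by
        rw [lintegral_add_left (by fun_prop), lintegral_const, hrs, hsuniv]
      _ ≤ _ := add_le_add_right (lintegral_mono' hrle le_rfl) _
  have hsm : ∫⁻ x, ENNReal.ofReal (‖x‖ ^ 2) ∂s =
      ∫⁻ x, (u x - v x) * ENNReal.ofReal (‖x‖ ^ 2) := by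
    rw [hs, lintegral_withDensity_eq_lintegral_mul _ (by fun_prop) (by fun_prop)]
    rfl
  refine key.trans ?_
  rw [hsm, add_right_comm]
  gcongr

lemma lintegral_norm_sq_le_W2sq (μ ν : Measure (EuclideanSpace ℝ (Fin d))) :
    ∫⁻ x, ENNReal.ofReal (‖x‖ ^ 2) ∂ν ≤
      2 * ∫⁻ x, ENNReal.ofReal (‖x‖ ^ 2) ∂μ + 2 * W2sq μ ν := by
  rcases eq_or_ne (W2sq μ ν) ⊤ with h | h
  · simp [h]
  refine ENNReal.le_of_forall_pos_le_add fun ε hε _ ↦ ?_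
  have hε' : (2⁻¹ * ε : ℝ≥0∞) ≠ 0 := by simpa using hε.ne'
  obtain ⟨π, h1, h2, h3⟩ := exists_coupling_lt (ENNReal.lt_add_right h hε')
  have hN : Measurable fun x : EuclideanSpace ℝ (Fin d) ↦ ENNReal.ofReal (‖x‖ ^ 2) := by fun_prop
  calc ∫⁻ x, ENNReal.ofReal (‖x‖ ^ 2) ∂ν
      = ∫⁻ p, ENNReal.ofReal (‖p.1 - (p.1 - p.2)‖ ^ 2) ∂π := by
        rw [← h2, lintegral_map hN measurable_snd]; simp
    _ ≤ ∫⁻ p, (2 * ENNReal.ofReal (‖p.1‖ ^ 2) + 2 * ENNReal.ofReal (‖p.1 - p.2‖ ^ 2)) ∂π :=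
        lintegral_mono fun p ↦ ofReal_norm_sub_sq_le _ _
    _ = 2 * ∫⁻ x, ENNReal.ofReal (‖x‖ ^ 2) ∂μ +
          2 * ∫⁻ p, ENNReal.ofReal (‖p.1 - p.2‖ ^ 2) ∂π := by
        rw [lintegral_add_left (by fun_prop), lintegral_const_mul _ (by fun_prop),
          lintegral_const_mul _ (by fun_prop), ← lintegral_map hN measurable_fst, h1]
    _ ≤ 2 * ∫⁻ x, ENNReal.ofReal (‖x‖ ^ 2) ∂μ + 2 * (W2sq μ ν + 2⁻¹ * ε) := by gcongr
    _ = _ := by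
        rw [mul_add, ← mul_assoc 2 2⁻¹, ENNReal.mul_inv_cancel (by simp) (by simp), one_mul,
          add_assoc]

/-- Lower semicontinuity of the squared Wasserstein distance under almost everywhere convergence
of densities. -/
lemma W2sq_withDensity_le_liminf (μ : Measure (EuclideanSpace ℝ (Fin d))) [IsProbabilityMeasure μ]
    (hμ : ∫⁻ x, ENNReal.ofReal (‖x‖ ^ 2) ∂μ ≠ ⊤)
    {u : EuclideanSpace ℝ (Fin d) → ℝ≥0∞} {v : ℕ → EuclideanSpace ℝ (Fin d) → ℝ≥0∞}
    (hu : Measurable u) (hv : ∀ n, Measurable (v n)) (hut : ∀ x, u x ≠ ⊤)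
    (hvt : ∀ n x, v n x ≠ ⊤) (hu1 : ∫⁻ x, u x = 1)
    (hum : ∫⁻ x, u x * ENNReal.ofReal (‖x‖ ^ 2) ≠ ⊤)
    (hlim : ∀ᵐ x, Tendsto (fun n ↦ v n x) atTop (𝓝 (u x))) :
    W2sq μ (volume.withDensity u) ≤
      liminf (fun n ↦ W2sq μ (volume.withDensity (v n))) atTop := by
  have hsub : ∀ᵐ x, Tendsto (fun n ↦ u x - v n x) atTop (𝓝 0) := by
    filter_upwards [hlim] with x hx
    simpa using ENNReal.Tendsto.sub tendsto_const_nhds hx (.inl (hut x))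
  have hmass : Tendsto (fun n ↦ ∫⁻ x, (u x - v n x)) atTop (𝓝 0) := by
    simpa using tendsto_lintegral_of_dominated_convergence (f := fun _ ↦ 0) u
      (fun n ↦ hu.sub (hv n)) (fun n ↦ ae_of_all _ fun x ↦ tsub_le_self) (by simp [hu1]) hsub
  have hmom : Tendsto (fun n ↦ ∫⁻ x, (u x - v n x) * ENNReal.ofReal (‖x‖ ^ 2)) atTop (𝓝 0) := by
    have := tendsto_lintegral_of_dominated_convergence (f := fun _ ↦ 0)
      (F := fun n x ↦ (u x - v n x) * ENNReal.ofReal (‖x‖ ^ 2))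
      (fun x ↦ u x * ENNReal.ofReal (‖x‖ ^ 2)) (μ := volume)
      (fun n ↦ (hu.sub (hv n)).mul (by fun_prop))
      (fun n ↦ ae_of_all _ fun x ↦ mul_le_mul_left tsub_le_self _) hum (by
        filter_upwards [hsub] with x hx
        simpa only [zero_mul] using ENNReal.Tendsto.mul_const hx
          (.inr (ENNReal.ofReal_ne_top (r := ‖x‖ ^ 2))))
    simpa using this
  have htail : Tendsto (fun k : ℕ ↦ ∫⁻ x, (ENNReal.ofReal (‖x‖ ^ 2) - k) ∂μ) atTop (𝓝 0) := by
    have := tendsto_lintegral_of_dominated_convergence (μ := μ) (f := fun _ ↦ 0)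
      (F := fun (k : ℕ) (x : EuclideanSpace ℝ (Fin d)) ↦ ENNReal.ofReal (‖x‖ ^ 2) - k)
      (fun x ↦ ENNReal.ofReal (‖x‖ ^ 2)) (fun k ↦ by fun_prop)
      (fun k ↦ ae_of_all _ fun x ↦ tsub_le_self) hμ (ae_of_all _ fun x ↦ by
        have := ENNReal.Tendsto.sub (tendsto_const_nhds (x := ENNReal.ofReal (‖x‖ ^ 2)))
          ENNReal.tendsto_nat_nhds_top (.inl ENNReal.ofReal_ne_top)
        simpa using this)
    simpa using this
  have hk : ∀ k : ℕ, W2sq μ (volume.withDensity u) ≤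
      liminf (fun n ↦ W2sq μ (volume.withDensity (v n))) atTop +
        2 * ∫⁻ x, (ENNReal.ofReal (‖x‖ ^ 2) - k) ∂μ := by
    intro k
    set b := ∫⁻ x, (ENNReal.ofReal (‖x‖ ^ 2) - k) ∂μ
    have hrem : Tendsto (fun n ↦ 2 * (k * ∫⁻ x, (u x - v n x)) +
        2 * ∫⁻ x, (u x - v n x) * ENNReal.ofReal (‖x‖ ^ 2)) atTop (𝓝 0) := by
      have h1 := ENNReal.Tendsto.const_mul (a := (2 : ℝ≥0∞))
        (ENNReal.Tendsto.const_mul hmass (.inr (ENNReal.natCast_ne_top k))) (.inr (by simp))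
      have h2 := ENNReal.Tendsto.const_mul (a := (2 : ℝ≥0∞)) hmom (.inr (by simp))
      simpa using h1.add h2
    rw [← ENNReal.liminf_add_of_right_tendsto_zero hrem,
      ← liminf_add_const _ _ _ (by isBoundedDefault) (by isBoundedDefault)]
    refine le_liminf_of_le (by isBoundedDefault) (Eventually.of_forall fun n ↦ ?_)
    refine (W2sq_withDensity_le μ hu (hv n) (hvt n) hu1 k).trans (le_of_eq ?_)
    simp only [Pi.add_apply]
    ring
  refine ge_of_tendsto' (?_ : Tendsto _ atTop (𝓝 _)) hk
  simpa using tendsto_const_nhds.add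
    (ENNReal.Tendsto.const_mul (a := (2 : ℝ≥0∞)) htail (.inr (by simp)))

end Coupling

/-- No mass is lost in an almost everywhere limit of probability densities with bounded second
moments and bounded `L^γ` norms, `γ > 1`. -/
lemma lintegral_eq_one_of_tendsto {d : ℕ} {γ : ℝ} (hγ : 1 < γ)
    {u : EuclideanSpace ℝ (Fin d) → ℝ≥0∞} {v : ℕ → EuclideanSpace ℝ (Fin d) → ℝ≥0∞}
    (hv : ∀ n, Measurable (v n)) (hv1 : ∀ n, ∫⁻ x, v n x = 1)
    {C : ℝ≥0∞} (hC : C ≠ ⊤) (hm : ∀ n, ∫⁻ x, v n x * ENNReal.ofReal (‖x‖ ^ 2) ≤ C)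
    (hE : ∀ n, ∫⁻ x, v n x ^ γ ≤ C)
    (hlim : ∀ᵐ x, Tendsto (fun n ↦ v n x) atTop (𝓝 (u x))) :
    ∫⁻ x, u x = 1 := by
  apply le_antisymm
  · calc ∫⁻ x, u x = ∫⁻ x, liminf (fun n ↦ v n x) atTop :=
        lintegral_congr_ae (by filter_upwards [hlim] with x hx using hx.liminf_eq.symm)
      _ ≤ liminf (fun n ↦ ∫⁻ x, v n x) atTop := lintegral_liminf_le hv
      _ = 1 := by simp [hv1]
  have hk : ∀ k : ℕ, 0 < k →
      1 ≤ (∫⁻ x, u x) + (((k : ℝ≥0∞) ^ 2)⁻¹ * C + ((k : ℝ≥0∞) ^ (γ - 1))⁻¹ * C) := by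
    intro k hk
    have hk0 : (k : ℝ≥0∞) ≠ 0 := by simpa using hk.ne'
    have hkt : (k : ℝ≥0∞) ≠ ⊤ := ENNReal.natCast_ne_top k
    set B := Metric.closedBall (0 : EuclideanSpace ℝ (Fin d)) k
    have hB : MeasurableSet B := Metric.isClosed_closedBall.measurableSet
    have hn : ∀ n, 1 ≤ (∫⁻ x in B, min (v n x) k) +
        (((k : ℝ≥0∞) ^ 2)⁻¹ * C + ((k : ℝ≥0∞) ^ (γ - 1))⁻¹ * C) := by
      intro n
      have hpt : ∀ x, v n x ≤ B.indicator (fun x ↦ min (v n x) k) x +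
          (((k : ℝ≥0∞) ^ 2)⁻¹ * (v n x * ENNReal.ofReal (‖x‖ ^ 2)) +
            ((k : ℝ≥0∞) ^ (γ - 1))⁻¹ * v n x ^ γ) := by
        intro x
        rcases le_or_gt (v n x) k with h | h
        · by_cases hx : x ∈ B
          · rw [Set.indicator_of_mem hx, min_eq_left h]
            exact le_self_add
          · have hx' : (k : ℝ) ≤ ‖x‖ := by
              simp only [B, Metric.mem_closedBall, dist_zero_right, not_le] at hx
              exact hx.le
            have h2 : (k : ℝ≥0∞) ^ 2 ≤ ENNReal.ofReal (‖x‖ ^ 2) := by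
              rw [← ENNReal.ofReal_natCast, ← ENNReal.ofReal_pow (by positivity)]
              exact ENNReal.ofReal_le_ofReal (by gcongr)
            calc v n x = ((k : ℝ≥0∞) ^ 2)⁻¹ * (v n x * (k : ℝ≥0∞) ^ 2) := by
                  rw [mul_comm, mul_assoc, ENNReal.mul_inv_cancel (by simp [hk.ne'])
                    (ENNReal.pow_ne_top hkt), mul_one]
              _ ≤ ((k : ℝ≥0∞) ^ 2)⁻¹ * (v n x * ENNReal.ofReal (‖x‖ ^ 2)) := by gcongr
              _ ≤ _ := le_self_add.trans le_add_self
        · have h1 : (k : ℝ≥0∞) ^ (γ - 1) ≠ 0 := by simp [ENNReal.rpow_eq_zero_iff, hk0, hkt]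
          have h2 : (k : ℝ≥0∞) ^ (γ - 1) ≠ ⊤ :=
            ENNReal.rpow_ne_top_of_nonneg (by linarith) hkt
          calc v n x = ((k : ℝ≥0∞) ^ (γ - 1))⁻¹ * ((k : ℝ≥0∞) ^ (γ - 1) * v n x ^ (1 : ℝ)) := by
                rw [← mul_assoc, ENNReal.inv_mul_cancel h1 h2, one_mul, ENNReal.rpow_one]
            _ ≤ ((k : ℝ≥0∞) ^ (γ - 1))⁻¹ * (v n x ^ (γ - 1) * v n x ^ (1 : ℝ)) := by
                gcongr
            _ = ((k : ℝ≥0∞) ^ (γ - 1))⁻¹ * v n x ^ γ := by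
                rw [← ENNReal.rpow_add_of_nonneg _ _ (by linarith) (by norm_num), sub_add_cancel]
            _ ≤ _ := le_add_self.trans le_add_self
      have hvn := hv n
      calc 1 = ∫⁻ x, v n x := (hv1 n).symm
        _ ≤ _ := lintegral_mono hpt
        _ = (∫⁻ x in B, min (v n x) k) +
            (((k : ℝ≥0∞) ^ 2)⁻¹ * (∫⁻ x, v n x * ENNReal.ofReal (‖x‖ ^ 2)) +
              ((k : ℝ≥0∞) ^ (γ - 1))⁻¹ * ∫⁻ x, v n x ^ γ) := by
          rw [lintegral_add_left ((by fun_prop : Measurable fun x ↦ min (v n x) k).indicator hB),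
            lintegral_indicator hB, lintegral_add_left (by fun_prop),
            lintegral_const_mul _ (by fun_prop), lintegral_const_mul _ (by fun_prop)]
        _ ≤ _ := by gcongr; exacts [hm n, hE n]
    have hT : Tendsto (fun n ↦ ∫⁻ x in B, min (v n x) k) atTop (𝓝 (∫⁻ x in B, min (u x) k)) := by
      refine tendsto_lintegral_of_dominated_convergence (fun _ ↦ (k : ℝ≥0∞))
        (fun n ↦ (hv n).min measurable_const) (fun n ↦ ae_of_all _ fun x ↦ min_le_right _ _) ?_ ?_
      · rw [lintegral_const, Measure.restrict_apply_univ]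
        exact ENNReal.mul_ne_top hkt measure_closedBall_lt_top.ne
      · filter_upwards [ae_restrict_of_ae hlim] with x hx using hx.min tendsto_const_nhds
    refine (ge_of_tendsto' (hT.add tendsto_const_nhds) hn).trans ?_
    exact add_le_add ((lintegral_mono fun x ↦ min_le_left _ _).trans
      (setLIntegral_le_lintegral _ _)) le_rfl
  have hkt : Tendsto (fun k : ℕ ↦ (k : ℝ≥0∞)) atTop (𝓝 ⊤) := ENNReal.tendsto_nat_nhds_top
  have h1 : Tendsto (fun k : ℕ ↦ ((k : ℝ≥0∞) ^ 2)⁻¹ * C) atTop (𝓝 0) := by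
    have := ENNReal.Tendsto.mul_const ((ENNReal.Tendsto.pow (n := 2) hkt).inv) (.inr hC)
    simpa using this
  have h2 : Tendsto (fun k : ℕ ↦ ((k : ℝ≥0∞) ^ (γ - 1))⁻¹ * C) atTop (𝓝 0) := by
    have h := (ENNReal.continuous_rpow_const (y := γ - 1)).tendsto ⊤ |>.comp hkt
    rw [ENNReal.top_rpow_of_pos (by linarith)] at h
    have := ENNReal.Tendsto.mul_const h.inv (.inr hC)
    simpa using this
  have h3 := (tendsto_const_nhds (x := ∫⁻ x, u x)).add (h1.add h2)
  simp only [add_zero] at h3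
  exact ge_of_tendsto h3 (by filter_upwards [eventually_gt_atTop 0] with k hk' using hk k hk')

/-- Probability densities on `ℝ^d` with finite second moment. -/
def IsMomentDensity {d : ℕ} (ρ : EuclideanSpace ℝ (Fin d) → ℝ) : Prop :=
  Measurable ρ ∧ (∀ x, 0 ≤ ρ x) ∧ (∫⁻ x, ENNReal.ofReal (ρ x) = 1) ∧
    ∫⁻ x, ENNReal.ofReal (‖x‖ ^ 2 * ρ x) < ⊤

/-- The functional minimized in one step of the minimizing movement scheme. -/
noncomputable def jkoFunctional {d : ℕ} (γ τ : ℝ) (ρ₀ ρ : EuclideanSpace ℝ (Fin d) → ℝ) : ℝ≥0∞ :=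
  ENNReal.ofReal (1 / (2 * τ)) *
      W2sq (volume.withDensity fun x => ENNReal.ofReal (ρ₀ x))
        (volume.withDensity fun x => ENNReal.ofReal (ρ x)) +
    ∫⁻ z, ENNReal.ofReal (ρ z ^ γ / (γ - 1))

section JKO

variable {d : ℕ} {γ τ : ℝ} {ρ₀ ρ ρ' : EuclideanSpace ℝ (Fin d) → ℝ}

lemma withDensity_midpoint (hρ : Measurable ρ) (h0 : ∀ x, 0 ≤ ρ x) (h0' : ∀ x, 0 ≤ ρ' x) :
    (volume.withDensity fun x ↦ ENNReal.ofReal ((ρ x + ρ' x) / 2)) =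
      (2⁻¹ : ℝ≥0∞) • ((volume.withDensity fun x ↦ ENNReal.ofReal (ρ x)) +
        volume.withDensity fun x ↦ ENNReal.ofReal (ρ' x)) := by
  rw [← withDensity_add_left (by fun_prop), ← withDensity_smul' _ _ (by simp)]
  congr 1
  ext x
  simp only [Pi.smul_apply, Pi.add_apply, smul_eq_mul]
  rw [ENNReal.ofReal_div_of_pos (by norm_num), ENNReal.ofReal_add (h0 x) (h0' x),
    ENNReal.div_eq_inv_mul, ENNReal.ofReal_ofNat]

lemma IsMomentDensity.midpoint (h : IsMomentDensity ρ) (h' : IsMomentDensity ρ') :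
    IsMomentDensity fun x ↦ (ρ x + ρ' x) / 2 := by
  obtain ⟨hm, h0, h1, h2⟩ := h
  obtain ⟨hm', h0', h1', h2'⟩ := h'
  refine ⟨by fun_prop, fun x ↦ by linarith [h0 x, h0' x], ?_, ?_⟩
  · have := congrArg (fun m : Measure (EuclideanSpace ℝ (Fin d)) ↦ m Set.univ)
      (withDensity_midpoint hm h0 h0')
    simp only [withDensity_apply _ MeasurableSet.univ, setLIntegral_univ, Measure.smul_apply,
      Measure.add_apply, h1, h1', smul_eq_mul] at this
    rw [this, one_add_one_eq_two, ENNReal.inv_mul_cancel (by simp) (by simp)]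
  · calc ∫⁻ x, ENNReal.ofReal (‖x‖ ^ 2 * ((ρ x + ρ' x) / 2))
        ≤ ∫⁻ x, (ENNReal.ofReal (‖x‖ ^ 2 * ρ x) + ENNReal.ofReal (‖x‖ ^ 2 * ρ' x)) := by
          refine lintegral_mono fun x ↦ ?_
          have := h0 x
          have := h0' x
          rw [← ENNReal.ofReal_add (by positivity) (by positivity)]
          refine ENNReal.ofReal_le_ofReal ?_
          nlinarith [sq_nonneg ‖x‖, mul_nonneg (sq_nonneg ‖x‖) (h0 x),
            mul_nonneg (sq_nonneg ‖x‖) (h0' x)]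
      _ < ⊤ := by
          rw [lintegral_add_left (by fun_prop)]
          exact ENNReal.add_lt_top.2 ⟨h2, h2'⟩

/-- Two almost minimizers are close: their powers `γ / 2` are close in `L²`. -/
lemma lintegral_sq_sub_le_of_jkoFunctional_le (hγ : 1 < γ)
    (h : IsMomentDensity ρ) (h' : IsMomentDensity ρ') {I δ : ℝ≥0∞} (hI : I ≠ ⊤)
    (hmid : I ≤ jkoFunctional γ τ ρ₀ fun x ↦ (ρ x + ρ' x) / 2)
    (hle : jkoFunctional γ τ ρ₀ ρ ≤ I + δ) (hle' : jkoFunctional γ τ ρ₀ ρ' ≤ I + δ) :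
    ENNReal.ofReal (min 1 (γ - 1) / 4 / (γ - 1)) *
      ∫⁻ x, ENNReal.ofReal ((ρ x ^ (γ / 2) - ρ' x ^ (γ / 2)) ^ 2) ≤ δ := by
  obtain ⟨hm, h0, -, -⟩ := h
  obtain ⟨hm', h0', -, -⟩ := h'
  have hγ' : 0 < γ - 1 := by linarith
  set k := min 1 (γ - 1) / 4 / (γ - 1) with hk
  have hk0 : 0 ≤ k := by have : 0 ≤ min 1 (γ - 1) := le_min (by norm_num) hγ'.le; positivity
  set c := ENNReal.ofReal (1 / (2 * τ))
  set J := ∫⁻ x, ENNReal.ofReal ((ρ x ^ (γ / 2) - ρ' x ^ (γ / 2)) ^ 2) with hJ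
  have hW : c * W2sq (volume.withDensity fun x ↦ ENNReal.ofReal (ρ₀ x))
        (volume.withDensity fun x ↦ ENNReal.ofReal ((ρ x + ρ' x) / 2)) ≤
      2⁻¹ * (c * W2sq (volume.withDensity fun x ↦ ENNReal.ofReal (ρ₀ x))
          (volume.withDensity fun x ↦ ENNReal.ofReal (ρ x)) +
        c * W2sq (volume.withDensity fun x ↦ ENNReal.ofReal (ρ₀ x))
          (volume.withDensity fun x ↦ ENNReal.ofReal (ρ' x))) := by
    rw [withDensity_midpoint hm h0 h0', ← mul_add, mul_left_comm]
    gcongr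
    exact W2sq_midpoint_le _ _ _
  have hE : (∫⁻ x, ENNReal.ofReal (((ρ x + ρ' x) / 2) ^ γ / (γ - 1))) + ENNReal.ofReal k * J ≤
      2⁻¹ * ((∫⁻ x, ENNReal.ofReal (ρ x ^ γ / (γ - 1))) +
        ∫⁻ x, ENNReal.ofReal (ρ' x ^ γ / (γ - 1))) := by
    rw [hJ, ← lintegral_const_mul _ (by fun_prop), ← lintegral_add_left (by fun_prop),
      ← lintegral_add_left (by fun_prop), ← lintegral_const_mul _ (by fun_prop)]
    refine lintegral_mono fun x ↦ ?_
    have h0 := h0 x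
    have h0' := h0' x
    rw [← ENNReal.ofReal_mul hk0, ← ENNReal.ofReal_add (by positivity) (by positivity),
      ← ENNReal.ofReal_add (by positivity) (by positivity),
      ← ENNReal.ofReal_ofNat, ← ENNReal.ofReal_inv_of_pos (by norm_num),
      ← ENNReal.ofReal_mul (by norm_num)]
    refine ENNReal.ofReal_le_ofReal ?_
    have := div_le_div_of_nonneg_right (midpoint_rpow_add_sq_le hγ h0 h0') hγ'.le
    calc _ = _ := by rw [hk]; ring
      _ ≤ _ := this
      _ = _ := by ring
  have key : I + ENNReal.ofReal k * J ≤ I + δ := by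
    calc I + ENNReal.ofReal k * J
        ≤ jkoFunctional γ τ ρ₀ (fun x ↦ (ρ x + ρ' x) / 2) + ENNReal.ofReal k * J := by gcongr
      _ ≤ 2⁻¹ * (jkoFunctional γ τ ρ₀ ρ + jkoFunctional γ τ ρ₀ ρ') := by
        unfold jkoFunctional
        rw [add_assoc]
        refine (add_le_add hW hE).trans (le_of_eq ?_)
        ring
      _ ≤ 2⁻¹ * ((I + δ) + (I + δ)) := by gcongr
      _ = I + δ := by
        rw [← two_mul, ← mul_assoc, ENNReal.inv_mul_cancel (by simp) (by simp), one_mul]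
  exact (ENNReal.add_le_add_iff_left hI).1 key

/-- A sequence of almost minimizers with fast decreasing error has an almost everywhere limit. -/
lemma exists_ae_tendsto_of_jkoFunctional_le (hγ : 1 < γ) {ρs : ℕ → EuclideanSpace ℝ (Fin d) → ℝ}
    (hρs : ∀ n, IsMomentDensity (ρs n)) {I : ℝ≥0∞} (hI : I ≠ ⊤)
    (hmin : ∀ ρ, IsMomentDensity ρ → I ≤ jkoFunctional γ τ ρ₀ ρ)
    (hle : ∀ n, jkoFunctional γ τ ρ₀ (ρs n) ≤
      I + ENNReal.ofReal (min 1 (γ - 1) / 4 / (γ - 1)) * (2⁻¹ ^ (n + 1)) ^ 2) :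
    ∃ ρ : EuclideanSpace ℝ (Fin d) → ℝ, Measurable ρ ∧ (∀ x, 0 ≤ ρ x) ∧
      ∀ᵐ x, Tendsto (fun n ↦ ρs n x) atTop (𝓝 (ρ x)) := by
  have hγ' : 0 < γ - 1 := by linarith
  set k := min 1 (γ - 1) / 4 / (γ - 1) with hk
  have hk0 : 0 < k := by have : 0 < min 1 (γ - 1) := lt_min (by norm_num) hγ'; positivity
  have hmeas : ∀ n, Measurable (ρs n) := fun n ↦ (hρs n).1
  have hlim : ∀ᵐ x, ∃ l : ℝ, Tendsto (fun n ↦ ρs n x ^ (γ / 2)) atTop (𝓝 l) := by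
    refine Lp.ae_tendsto_of_cauchy_eLpNorm (p := 2) (μ := volume) (B := fun n ↦ 2⁻¹ ^ n)
      (f := fun n x ↦ ρs n x ^ (γ / 2))
      (fun n ↦ by have := hmeas n; exact Measurable.aestronglyMeasurable (by fun_prop))
      (by norm_num) (by simp [ENNReal.tsum_geometric]) ?_
    intro N n m hn hm
    have hmono : ∀ n, N ≤ n → jkoFunctional γ τ ρ₀ (ρs n) ≤
        I + ENNReal.ofReal k * (2⁻¹ ^ (N + 1)) ^ 2 := fun n hn ↦ by
      refine (hle n).trans ?_
      gcongr I + _ * ?_ ^ 2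
      exact pow_le_pow_of_le_one (by simp) (by simp) (by omega)
    have h := lintegral_sq_sub_le_of_jkoFunctional_le hγ (hρs n) (hρs m) hI
      (hmin _ ((hρs n).midpoint (hρs m))) (hmono n hn) (hmono m hm)
    have hJ := (ENNReal.mul_le_mul_iff_right (by simpa using hk0) ENNReal.ofReal_ne_top).1 h
    have hb : eLpNorm ((fun x ↦ ρs n x ^ (γ / 2)) - fun x ↦ ρs m x ^ (γ / 2)) 2 volume ≤
        2⁻¹ ^ (N + 1) := by
      rw [eLpNorm_eq_lintegral_rpow_enorm_toReal (by simp) (by simp)]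
      simp only [ENNReal.toReal_ofNat, Pi.sub_apply]
      rw [one_div, ENNReal.rpow_inv_le_iff (by norm_num), ENNReal.rpow_two]
      refine le_trans (le_of_eq (lintegral_congr fun x ↦ ?_)) hJ
      rw [ENNReal.rpow_two, ← ofReal_norm, ← ENNReal.ofReal_pow (norm_nonneg _), Real.norm_eq_abs,
        sq_abs]
    refine hb.trans_lt ?_
    rw [← ENNReal.inv_pow, ← ENNReal.inv_pow, ENNReal.inv_lt_inv, pow_succ]
    have h2 : (2 ^ N : ℝ≥0∞) = ((2 ^ N : ℕ) : ℝ≥0∞) := by simp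
    have := Nat.two_pow_pos N
    rw [h2]
    norm_cast
    omega
  have hlim' : ∀ᵐ x, ∃ l : ℝ, Tendsto (fun n ↦ ρs n x) atTop (𝓝 l) := by
    filter_upwards [hlim] with x ⟨l, hl⟩
    refine ⟨l ^ (2 / γ), ?_⟩
    have hc := ((Real.continuous_rpow_const (q := 2 / γ) (by positivity)).tendsto l).comp hl
    refine hc.congr fun n ↦ ?_
    simp only [Function.comp_apply]
    rw [← Real.rpow_mul ((hρs n).2.1 x), show γ / 2 * (2 / γ) = 1 by field_simp, Real.rpow_one]
  obtain ⟨ρ, hρ, hρl⟩ := measurable_limit_of_tendsto_metrizable_ae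
    (fun n ↦ (hmeas n).aemeasurable) hlim'
  refine ⟨fun x ↦ max 0 (ρ x), by fun_prop, fun x ↦ le_max_left _ _, ?_⟩
  filter_upwards [hρl] with x hx
  rwa [max_eq_right (ge_of_tendsto' hx fun n ↦ (hρs n).2.1 x)]

lemma lintegral_ofReal_rpow_div (hγ : 1 < γ) (hρ : Measurable ρ) :
    ∫⁻ x, ENNReal.ofReal (ρ x ^ γ / (γ - 1)) =
      ENNReal.ofReal ((γ - 1)⁻¹) * ∫⁻ x, ENNReal.ofReal (ρ x ^ γ) := by
  have hγ' : 0 ≤ (γ - 1)⁻¹ := inv_nonneg.2 (by linarith)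
  rw [← lintegral_const_mul _ (by fun_prop)]
  exact lintegral_congr fun x ↦ by rw [div_eq_inv_mul, ENNReal.ofReal_mul hγ']

lemma lintegral_withDensity_norm_sq (hρ : Measurable ρ) :
    ∫⁻ x, ENNReal.ofReal (‖x‖ ^ 2) ∂(volume.withDensity fun x ↦ ENNReal.ofReal (ρ x)) =
      ∫⁻ x, ENNReal.ofReal (‖x‖ ^ 2 * ρ x) := by
  rw [lintegral_withDensity_eq_lintegral_mul _ (by fun_prop) (by fun_prop)]
  refine lintegral_congr fun x ↦ ?_
  rw [Pi.mul_apply, mul_comm, ENNReal.ofReal_mul (by positivity)]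

lemma jkoFunctional_self : jkoFunctional γ τ ρ ρ = ∫⁻ x, ENNReal.ofReal (ρ x ^ γ / (γ - 1)) := by
  rw [jkoFunctional, W2sq_self, mul_zero, zero_add]

lemma lintegral_norm_sq_le_of_jkoFunctional_le (hτ : 0 < τ) (hρ₀ : Measurable ρ₀)
    (hρ : Measurable ρ) {M : ℝ≥0∞} (h : jkoFunctional γ τ ρ₀ ρ ≤ M) :
    ∫⁻ x, ENNReal.ofReal (‖x‖ ^ 2 * ρ x) ≤
      2 * (∫⁻ x, ENNReal.ofReal (‖x‖ ^ 2 * ρ₀ x)) + 2 * (ENNReal.ofReal (2 * τ) * M) := by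
  rw [← lintegral_withDensity_norm_sq hρ, ← lintegral_withDensity_norm_sq hρ₀]
  refine (lintegral_norm_sq_le_W2sq (volume.withDensity fun x ↦ ENNReal.ofReal (ρ₀ x)) _).trans ?_
  gcongr
  calc _ = ENNReal.ofReal (2 * τ) * (ENNReal.ofReal (1 / (2 * τ)) *
        W2sq (volume.withDensity fun x ↦ ENNReal.ofReal (ρ₀ x))
          (volume.withDensity fun x ↦ ENNReal.ofReal (ρ x))) := by
        rw [← mul_assoc, ← ENNReal.ofReal_mul (by positivity),
          show 2 * τ * (1 / (2 * τ)) = 1 by field_simp, ENNReal.ofReal_one, one_mul]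
    _ ≤ _ := by
        gcongr
        exact le_self_add.trans h

lemma lintegral_rpow_le_of_jkoFunctional_le (hγ : 1 < γ) (hρ : Measurable ρ) {M : ℝ≥0∞}
    (h : jkoFunctional γ τ ρ₀ ρ ≤ M) :
    ∫⁻ x, ENNReal.ofReal (ρ x ^ γ) ≤ ENNReal.ofReal (γ - 1) * M := by
  have hγ' : 0 < γ - 1 := by linarith
  calc _ = ENNReal.ofReal (γ - 1) * ∫⁻ x, ENNReal.ofReal (ρ x ^ γ / (γ - 1)) := by
        rw [lintegral_ofReal_rpow_div hγ hρ, ← mul_assoc, ← ENNReal.ofReal_mul hγ'.le,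
          mul_inv_cancel₀ hγ'.ne', ENNReal.ofReal_one, one_mul]
    _ ≤ _ := by
        gcongr
        exact le_add_self.trans h

/-- Almost everywhere limits preserve moment densities, provided the functional is bounded. -/
lemma IsMomentDensity.of_ae_tendsto (hγ : 1 < γ) (hτ : 0 < τ) (h₀ : IsMomentDensity ρ₀)
    {ρs : ℕ → EuclideanSpace ℝ (Fin d) → ℝ} (hρs : ∀ n, IsMomentDensity (ρs n)) {M : ℝ≥0∞}
    (hM : M ≠ ⊤) (hle : ∀ n, jkoFunctional γ τ ρ₀ (ρs n) ≤ M) (hρ : Measurable ρ)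
    (h0 : ∀ x, 0 ≤ ρ x) (hlim : ∀ᵐ x, Tendsto (fun n ↦ ρs n x) atTop (𝓝 (ρ x))) :
    IsMomentDensity ρ := by
  obtain ⟨hm₀, -, -, h2₀⟩ := h₀
  set C₁ := 2 * (∫⁻ x, ENNReal.ofReal (‖x‖ ^ 2 * ρ₀ x)) + 2 * (ENNReal.ofReal (2 * τ) * M)
  have hC₁ : C₁ ≠ ⊤ := ENNReal.add_ne_top.2 ⟨ENNReal.mul_ne_top (by simp) h2₀.ne,
    ENNReal.mul_ne_top (by simp) (ENNReal.mul_ne_top ENNReal.ofReal_ne_top hM)⟩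
  have hmom : ∀ n, ∫⁻ x, ENNReal.ofReal (‖x‖ ^ 2 * ρs n x) ≤ C₁ := fun n ↦
    lintegral_norm_sq_le_of_jkoFunctional_le hτ hm₀ (hρs n).1 (hle n)
  refine ⟨hρ, h0, ?_, ?_⟩
  · refine lintegral_eq_one_of_tendsto hγ (v := fun n x ↦ ENNReal.ofReal (ρs n x))
      (C := C₁ + ENNReal.ofReal (γ - 1) * M) (fun n ↦ (hρs n).1.ennreal_ofReal)
      (fun n ↦ (hρs n).2.2.1) (ENNReal.add_ne_top.2 ⟨hC₁, ENNReal.mul_ne_top (by simp) hM⟩)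
      (fun n ↦ ?_) (fun n ↦ ?_) ?_
    · refine le_trans (le_of_eq (lintegral_congr fun x ↦ ?_)) ((hmom n).trans le_self_add)
      rw [mul_comm, ENNReal.ofReal_mul (by positivity)]
    · refine le_trans (le_of_eq (lintegral_congr fun x ↦ ?_))
        ((lintegral_rpow_le_of_jkoFunctional_le hγ (hρs n).1 (hle n)).trans le_add_self)
      rw [ENNReal.ofReal_rpow_of_nonneg ((hρs n).2.1 x) (by linarith)]
    · filter_upwards [hlim] with x hx using ENNReal.tendsto_ofReal hx
  · calc ∫⁻ x, ENNReal.ofReal (‖x‖ ^ 2 * ρ x)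
        = ∫⁻ x, liminf (fun n ↦ ENNReal.ofReal (‖x‖ ^ 2 * ρs n x)) atTop := by
          refine lintegral_congr_ae ?_
          filter_upwards [hlim] with x hx using
            (ENNReal.tendsto_ofReal (hx.const_mul _)).liminf_eq.symm
      _ ≤ liminf (fun n ↦ ∫⁻ x, ENNReal.ofReal (‖x‖ ^ 2 * ρs n x)) atTop :=
          lintegral_liminf_le fun n ↦ by have := (hρs n).1; fun_prop
      _ ≤ C₁ := by
          refine (liminf_le_liminf (.of_forall hmom)).trans (by simp)
      _ < ⊤ := hC₁.lt_top

lemma liminf_add_liminf_le_liminf_add (u v : ℕ → ℝ≥0∞) :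
    liminf u atTop + liminf v atTop ≤ liminf (fun n ↦ u n + v n) atTop := by
  simp only [liminf_eq_iSup_iInf_of_nat]
  rw [ENNReal.iSup_add_iSup_of_monotone]
  · gcongr with n
    exact le_iInf₂ fun i hi ↦ add_le_add (iInf₂_le i hi) (iInf₂_le i hi)
  all_goals exact fun m n hmn ↦ le_iInf₂ fun i hi ↦ iInf₂_le i (hmn.trans hi)

lemma jkoFunctional_le_liminf (hγ : 1 < γ) (h₀ : IsMomentDensity ρ₀)
    {ρs : ℕ → EuclideanSpace ℝ (Fin d) → ℝ} (hρs : ∀ n, IsMomentDensity (ρs n))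
    (hρ : IsMomentDensity ρ) (hlim : ∀ᵐ x, Tendsto (fun n ↦ ρs n x) atTop (𝓝 (ρ x))) :
    jkoFunctional γ τ ρ₀ ρ ≤ liminf (fun n ↦ jkoFunctional γ τ ρ₀ (ρs n)) atTop := by
  obtain ⟨hm₀, -, h1₀, h2₀⟩ := h₀
  obtain ⟨hm, h0, h1, h2⟩ := hρ
  have : IsProbabilityMeasure (volume.withDensity fun x ↦ ENNReal.ofReal (ρ₀ x)) :=
    ⟨by rw [withDensity_apply _ MeasurableSet.univ, setLIntegral_univ, h1₀]⟩
  have hW := W2sq_withDensity_le_liminf (volume.withDensity fun x ↦ ENNReal.ofReal (ρ₀ x))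
    (by rw [lintegral_withDensity_norm_sq hm₀]; exact h2₀.ne) hm.ennreal_ofReal
    (fun n ↦ (hρs n).1.ennreal_ofReal) (by simp) (by simp) h1
    (by rw [← lintegral_congr fun x ↦ (mul_comm _ _).trans
          (ENNReal.ofReal_mul (q := ρ x) (sq_nonneg ‖x‖)).symm] at *; exact h2.ne)
    (by filter_upwards [hlim] with x hx using ENNReal.tendsto_ofReal hx)
  have hE : ∫⁻ x, ENNReal.ofReal (ρ x ^ γ / (γ - 1)) ≤
      liminf (fun n ↦ ∫⁻ x, ENNReal.ofReal (ρs n x ^ γ / (γ - 1))) atTop := by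
    refine le_trans (le_of_eq (lintegral_congr_ae ?_))
      (lintegral_liminf_le fun n ↦ by have := (hρs n).1; fun_prop)
    filter_upwards [hlim] with x hx
    exact (ENNReal.tendsto_ofReal ((hx.rpow_const (.inr (by linarith))).div_const _)).liminf_eq.symm
  refine (add_le_add (mul_le_mul_right hW _) hE).trans ?_
  rw [← ENNReal.liminf_const_mul_of_ne_top ENNReal.ofReal_ne_top]
  unfold jkoFunctional
  exact liminf_add_liminf_le_liminf_add _ _

lemma exists_jkoFunctional_le (hγ : 1 < γ) (hτ : 0 < τ) (h₀ : IsMomentDensity ρ₀)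
    (hE₀ : ∫⁻ x, ENNReal.ofReal (ρ₀ x ^ γ) < ⊤) :
    ∃ ρ₁, IsMomentDensity ρ₁ ∧ jkoFunctional γ τ ρ₀ ρ₁ ≠ ⊤ ∧
      ∀ ρ, IsMomentDensity ρ → jkoFunctional γ τ ρ₀ ρ₁ ≤ jkoFunctional γ τ ρ₀ ρ := by
  have hγ' : 0 < γ - 1 := by linarith
  set I := ⨅ (ρ : EuclideanSpace ℝ (Fin d) → ℝ) (_ : IsMomentDensity ρ), jkoFunctional γ τ ρ₀ ρ
    with hI_def
  have hmin : ∀ ρ, IsMomentDensity ρ → I ≤ jkoFunctional γ τ ρ₀ ρ := fun ρ hρ ↦ iInf₂_le ρ hρ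
  have hI : I ≠ ⊤ := by
    refine ne_top_of_le_ne_top ?_ (hmin ρ₀ h₀)
    rw [jkoFunctional_self, lintegral_ofReal_rpow_div hγ h₀.1]
    exact ENNReal.mul_ne_top (by simp) hE₀.ne
  set k := ENNReal.ofReal (min 1 (γ - 1) / 4 / (γ - 1)) with hk
  have hk0 : k ≠ 0 := by
    have : 0 < min 1 (γ - 1) := lt_min (by norm_num) hγ'
    rw [hk, Ne, ENNReal.ofReal_eq_zero, not_le]
    positivity
  have hkt : k ≠ ⊤ := ENNReal.ofReal_ne_top
  have hex : ∀ n : ℕ, ∃ ρ, IsMomentDensity ρ ∧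
      jkoFunctional γ τ ρ₀ ρ < I + k * (2⁻¹ ^ (n + 1)) ^ 2 := fun n ↦ by
    have : I < I + k * (2⁻¹ ^ (n + 1)) ^ 2 := ENNReal.lt_add_right hI (by simp [hk0])
    simpa only [hI_def, iInf_lt_iff, exists_prop] using this
  choose ρs hρs hlt using hex
  obtain ⟨ρ₁, hm, h0, hlim⟩ :=
    exists_ae_tendsto_of_jkoFunctional_le hγ hρs hI hmin fun n ↦ (hlt n).le
  have hle : ∀ n, jkoFunctional γ τ ρ₀ (ρs n) ≤ I + k := fun n ↦ by
    refine (hlt n).le.trans ?_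
    gcongr
    exact mul_le_of_le_one_right' (pow_le_one' (pow_le_one' (by simp) _) _)
  have hρ₁ := IsMomentDensity.of_ae_tendsto hγ hτ h₀ hρs (ENNReal.add_ne_top.2 ⟨hI, hkt⟩) hle
    hm h0 hlim
  have hδ : Tendsto (fun n : ℕ ↦ I + k * (2⁻¹ ^ (n + 1)) ^ 2) atTop (𝓝 I) := by
    have h1 : Tendsto (fun n : ℕ ↦ ((2⁻¹ : ℝ≥0∞) ^ (n + 1)) ^ 2) atTop (𝓝 (0 ^ 2)) :=
      ((ENNReal.continuous_pow 2).tendsto 0).comp ((tendsto_add_atTop_iff_nat 1).2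
        (ENNReal.tendsto_pow_atTop_nhds_zero_of_lt_one (by simp)))
    simpa using tendsto_const_nhds.add (ENNReal.Tendsto.const_mul h1 (.inr hkt))
  have hle₁ : jkoFunctional γ τ ρ₀ ρ₁ ≤ I := by
    refine (jkoFunctional_le_liminf hγ h₀ hρs hρ₁ hlim).trans ?_
    exact (liminf_le_liminf (.of_forall fun n ↦ (hlt n).le)).trans hδ.liminf_eq.le
  exact ⟨ρ₁, hρ₁, ne_top_of_le_ne_top hI hle₁, fun ρ hρ ↦ hle₁.trans (hmin ρ hρ)⟩

lemma ae_eq_of_jkoFunctional_le (hγ : 1 < γ) (h : IsMomentDensity ρ) (h' : IsMomentDensity ρ')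
    (hI : jkoFunctional γ τ ρ₀ ρ' ≠ ⊤)
    (hmin : ∀ σ, IsMomentDensity σ → jkoFunctional γ τ ρ₀ ρ' ≤ jkoFunctional γ τ ρ₀ σ)
    (hle : jkoFunctional γ τ ρ₀ ρ ≤ jkoFunctional γ τ ρ₀ ρ') : ρ =ᵐ[volume] ρ' := by
  have hγ' : 0 < γ - 1 := by linarith
  have hk : 0 < min 1 (γ - 1) / 4 / (γ - 1) := by
    have : 0 < min 1 (γ - 1) := lt_min (by norm_num) hγ'
    positivity
  have hz := lintegral_sq_sub_le_of_jkoFunctional_le hγ h h' hI (hmin _ (h.midpoint h'))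
    (δ := 0) (by simpa using hle) (by simp)
  have hm := h.1
  have hm' := h'.1
  rw [nonpos_iff_eq_zero, mul_eq_zero, ENNReal.ofReal_eq_zero, or_iff_right hk.not_ge,
    lintegral_eq_zero_iff (by fun_prop)] at hz
  filter_upwards [hz] with x hx
  rw [Pi.zero_apply, ENNReal.ofReal_eq_zero] at hx
  exact (Real.rpow_left_inj (h.2.1 x) (h'.2.1 x) (by linarith)).1
    (sub_eq_zero.1 (pow_eq_zero_iff two_ne_zero |>.1 (hx.antisymm (sq_nonneg _))))

end JKO

/-- **Well-posedness and energy decrease for the minimizing movement (JKO) step.**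
Given a probability density `ρ₀` on `ℝ^d` with finite second moment and `∫ ρ₀^γ < ∞`,
the functional `ρ ↦ (1/(2τ)) W(ρ₀·Leb, ρ·Leb)² + ∫ ρ^γ/(γ-1)` admits a minimizer `ρ₁`
among probability densities with finite second moment; the minimizer is unique up to
Lebesgue-a.e. equality; and `∫ ρ₁^γ ≤ ∫ ρ₀^γ`. -/
theorem jko_step_wellposed (d : ℕ) (hd : 1 ≤ d) (γ τ : ℝ) (hγ : 1 < γ) (hτ : 0 < τ)
    (ρ₀ : EuclideanSpace ℝ (Fin d) → ℝ)
    (hρ₀_meas : Measurable ρ₀) (hρ₀_nonneg : ∀ x, 0 ≤ ρ₀ x)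
    (hρ₀_prob : ∫⁻ x, ENNReal.ofReal (ρ₀ x) = 1)
    (hρ₀_mom : ∫⁻ x, ENNReal.ofReal (‖x‖ ^ 2 * ρ₀ x) < ⊤)
    (hρ₀_energy : ∫⁻ x, ENNReal.ofReal (ρ₀ x ^ γ) < ⊤) :
    ∃ ρ₁ : EuclideanSpace ℝ (Fin d) → ℝ,
      (Measurable ρ₁ ∧ (∀ x, 0 ≤ ρ₁ x) ∧ (∫⁻ x, ENNReal.ofReal (ρ₁ x) = 1) ∧
        ∫⁻ x, ENNReal.ofReal (‖x‖ ^ 2 * ρ₁ x) < ⊤) ∧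
      (∀ ρ : EuclideanSpace ℝ (Fin d) → ℝ, Measurable ρ → (∀ x, 0 ≤ ρ x) →
        (∫⁻ x, ENNReal.ofReal (ρ x) = 1) →
        (∫⁻ x, ENNReal.ofReal (‖x‖ ^ 2 * ρ x) < ⊤) →
        ENNReal.ofReal (1 / (2 * τ)) *
            W2sq (volume.withDensity fun x => ENNReal.ofReal (ρ₀ x))
              (volume.withDensity fun x => ENNReal.ofReal (ρ₁ x)) +
            ∫⁻ z, ENNReal.ofReal (ρ₁ z ^ γ / (γ - 1)) ≤
          ENNReal.ofReal (1 / (2 * τ)) *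
              W2sq (volume.withDensity fun x => ENNReal.ofReal (ρ₀ x))
                (volume.withDensity fun x => ENNReal.ofReal (ρ x)) +
            ∫⁻ z, ENNReal.ofReal (ρ z ^ γ / (γ - 1))) ∧
      (∀ ρ : EuclideanSpace ℝ (Fin d) → ℝ, Measurable ρ → (∀ x, 0 ≤ ρ x) →
        (∫⁻ x, ENNReal.ofReal (ρ x) = 1) →
        (∫⁻ x, ENNReal.ofReal (‖x‖ ^ 2 * ρ x) < ⊤) →
        (∀ ρ' : EuclideanSpace ℝ (Fin d) → ℝ, Measurable ρ' → (∀ x, 0 ≤ ρ' x) →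
          (∫⁻ x, ENNReal.ofReal (ρ' x) = 1) →
          (∫⁻ x, ENNReal.ofReal (‖x‖ ^ 2 * ρ' x) < ⊤) →
          ENNReal.ofReal (1 / (2 * τ)) *
              W2sq (volume.withDensity fun x => ENNReal.ofReal (ρ₀ x))
                (volume.withDensity fun x => ENNReal.ofReal (ρ x)) +
              ∫⁻ z, ENNReal.ofReal (ρ z ^ γ / (γ - 1)) ≤
            ENNReal.ofReal (1 / (2 * τ)) *
                W2sq (volume.withDensity fun x => ENNReal.ofReal (ρ₀ x))
                  (volume.withDensity fun x => ENNReal.ofReal (ρ' x)) +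
              ∫⁻ z, ENNReal.ofReal (ρ' z ^ γ / (γ - 1))) →
        ρ =ᵐ[volume] ρ₁) ∧
      ∫⁻ x, ENNReal.ofReal (ρ₁ x ^ γ) ≤ ∫⁻ x, ENNReal.ofReal (ρ₀ x ^ γ) := by
  have h₀ : IsMomentDensity ρ₀ := ⟨hρ₀_meas, hρ₀_nonneg, hρ₀_prob, hρ₀_mom⟩
  obtain ⟨ρ₁, hρ₁, hI, hmin⟩ := exists_jkoFunctional_le hγ hτ h₀ hρ₀_energy
  refine ⟨ρ₁, hρ₁, fun ρ hm h0 h1 h2 ↦ hmin ρ ⟨hm, h0, h1, h2⟩, ?_, ?_⟩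
  · intro ρ hm h0 h1 h2 hρ
    exact ae_eq_of_jkoFunctional_le hγ ⟨hm, h0, h1, h2⟩ hρ₁ hI hmin
      (hρ ρ₁ hρ₁.1 hρ₁.2.1 hρ₁.2.2.1 hρ₁.2.2.2)
  · have h : ENNReal.ofReal (γ - 1)⁻¹ * ∫⁻ x, ENNReal.ofReal (ρ₁ x ^ γ) ≤
        ENNReal.ofReal (γ - 1)⁻¹ * ∫⁻ x, ENNReal.ofReal (ρ₀ x ^ γ) := by
      rw [← lintegral_ofReal_rpow_div hγ hρ₁.1, ← lintegral_ofReal_rpow_div hγ h₀.1,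
        ← jkoFunctional_self (τ := τ) (ρ := ρ₀)]
      exact le_add_self.trans (hmin ρ₀ h₀)
    have hγ' : ENNReal.ofReal (γ - 1)⁻¹ ≠ 0 := by simpa using hγ
    exact (ENNReal.mul_le_mul_iff_right hγ' ENNReal.ofReal_ne_top).1 h
end
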